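/- For every λ > 0 and x ∈ ℝ² the following identity holds: Δ(∂_λπ_λ)(x) + |∇π_λ(x)|² ∂_λπ_λ(x) = −(2/λ) |∇π_λ(x)|² π_λ³(x) π_λ(x), where π_λ³ denotes the third component of π_λ. -/

import Mathlib

noncomputable section

/-- The rescaled inverse stereographic projection `π_λ : ℝ² → ℝ³`. -/
def piL (lam : ℝ) (x : ℝ × ℝ) : Fin 3 → ℝ :=
  ![2 * lam * x.1 / (1 + lam ^ 2 * (x.1 ^ 2 + x.2 ^ 2)),
    2 * lam * x.2 / (1 + lam ^ 2 * (x.1 ^ 2 + x.2 ^ 2)),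
    (1 - lam ^ 2 * (x.1 ^ 2 + x.2 ^ 2)) / (1 + lam ^ 2 * (x.1 ^ 2 + x.2 ^ 2))]

/-- Euclidean dot product on ℝ³. -/
def dot3 (v w : Fin 3 → ℝ) : ℝ := v 0 * w 0 + v 1 * w 1 + v 2 * w 2

/-- First Euclidean partial derivative of an ℝ³-valued map on ℝ². -/
def pd1 (f : ℝ × ℝ → Fin 3 → ℝ) (x : ℝ × ℝ) : Fin 3 → ℝ := fderiv ℝ f x (1, 0)

/-- Second Euclidean partial derivative of an ℝ³-valued map on ℝ². -/
def pd2 (f : ℝ × ℝ → Fin 3 → ℝ) (x : ℝ × ℝ) : Fin 3 → ℝ := fderiv ℝ f x (0, 1)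

/-- The componentwise Euclidean Laplacian. -/
def lap (f : ℝ × ℝ → Fin 3 → ℝ) (x : ℝ × ℝ) : Fin 3 → ℝ := pd1 (pd1 f) x + pd2 (pd2 f) x

/-- First Euclidean partial derivative of a scalar function on ℝ². -/
def pds1 (f : ℝ × ℝ → ℝ) (x : ℝ × ℝ) : ℝ := fderiv ℝ f x (1, 0)

/-- Second Euclidean partial derivative of a scalar function on ℝ². -/
def pds2 (f : ℝ × ℝ → ℝ) (x : ℝ × ℝ) : ℝ := fderiv ℝ f x (0, 1)

/-- The energy density `|∇f|² = |∂₁f|² + |∂₂f|²`. -/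
def gradSq (f : ℝ × ℝ → Fin 3 → ℝ) (x : ℝ × ℝ) : ℝ :=
  dot3 (pd1 f x) (pd1 f x) + dot3 (pd2 f x) (pd2 f x)

/-- The derivative `∂_λ π_λ` with respect to the scale parameter. -/
def dlamPi (lam : ℝ) (x : ℝ × ℝ) : Fin 3 → ℝ := deriv (fun l => piL l x) lam

/-- A partial derivative of a differentiable map is computed componentwise along a line. -/
theorem pd1_eq_of_hasDerivAt {f : ℝ × ℝ → Fin 3 → ℝ} {x : ℝ × ℝ} {g : Fin 3 → ℝ}
    (hf : DifferentiableAt ℝ f x)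
    (hg : ∀ i, HasDerivAt (fun t => f (t, x.2) i) (g i) x.1) : pd1 f x = g := by
  have hl : HasDerivAt (fun t : ℝ => (t, x.2)) ((1 : ℝ), (0 : ℝ)) x.1 :=
    (hasDerivAt_id x.1).prodMk (hasDerivAt_const x.1 x.2)
  exact (hf.hasFDerivAt.comp_hasDerivAt (f := fun t : ℝ => (t, x.2)) x.1 hl).unique
    (hasDerivAt_pi.2 hg)

/-- A partial derivative of a differentiable map is computed componentwise along a line. -/
theorem pd2_eq_of_hasDerivAt {f : ℝ × ℝ → Fin 3 → ℝ} {x : ℝ × ℝ} {g : Fin 3 → ℝ}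
    (hf : DifferentiableAt ℝ f x)
    (hg : ∀ i, HasDerivAt (fun t => f (x.1, t) i) (g i) x.2) : pd2 f x = g := by
  have hl : HasDerivAt (fun t : ℝ => (x.1, t)) ((0 : ℝ), (1 : ℝ)) x.2 :=
    (hasDerivAt_const x.2 x.1).prodMk (hasDerivAt_id x.2)
  exact (hf.hasFDerivAt.comp_hasDerivAt (f := fun t : ℝ => (x.1, t)) x.2 hl).unique
    (hasDerivAt_pi.2 hg)

/-- The quotient rule for a denominator that is a power. -/
theorem HasDerivAt.div_pow_succ {N D : ℝ → ℝ} {n d t : ℝ} (k : ℕ) (hN : HasDerivAt N n t)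
    (hD : HasDerivAt D d t) (h0 : D t ≠ 0) :
    HasDerivAt (fun s => N s / D s ^ (k + 1))
      ((n * D t - (k + 1) * N t * d) / D t ^ (k + 2)) t := by
  refine (hN.fun_div (hD.fun_pow (k + 1)) (pow_ne_zero _ h0)).congr_deriv ?_
  simp only [Nat.add_sub_cancel]
  push_cast
  field_simp
  ring

/-- The common denominator `1 + λ²|x|²`. -/
def stereoDenom (lam : ℝ) (x : ℝ × ℝ) : ℝ := 1 + lam ^ 2 * (x.1 ^ 2 + x.2 ^ 2)

theorem stereoDenom_pos (lam : ℝ) (x : ℝ × ℝ) : 0 < stereoDenom lam x := by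
  unfold stereoDenom; positivity

theorem hasDerivAt_stereoDenom_fst (lam : ℝ) (x : ℝ × ℝ) :
    HasDerivAt (fun t => stereoDenom lam (t, x.2)) (2 * lam ^ 2 * x.1) x.1 := by
  unfold stereoDenom
  refine (((((hasDerivAt_id' x.1).fun_pow 2).add_const (x.2 ^ 2)).const_mul
    (lam ^ 2)).const_add 1).congr_deriv ?_
  simp; ring

theorem hasDerivAt_stereoDenom_snd (lam : ℝ) (x : ℝ × ℝ) :
    HasDerivAt (fun t => stereoDenom lam (x.1, t)) (2 * lam ^ 2 * x.2) x.2 := by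
  unfold stereoDenom
  refine (((((hasDerivAt_id' x.2).fun_pow 2).const_add (x.1 ^ 2)).const_mul
    (lam ^ 2)).const_add 1).congr_deriv ?_
  simp; ring

theorem hasDerivAt_stereoDenom_scale (lam : ℝ) (x : ℝ × ℝ) :
    HasDerivAt (fun l => stereoDenom l x) (2 * lam * (x.1 ^ 2 + x.2 ^ 2)) lam := by
  unfold stereoDenom
  refine ((((hasDerivAt_id' lam).fun_pow 2).mul_const (x.1 ^ 2 + x.2 ^ 2)).const_add
    1).congr_deriv ?_
  simp

@[fun_prop]
theorem differentiable_stereoDenom (lam : ℝ) : Differentiable ℝ (stereoDenom lam) := by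
  unfold stereoDenom; fun_prop

/-- The map into `ℝ³` with numerators `N` over the power `k` of the common denominator. -/
def stereoQuot (lam : ℝ) (k : ℕ) (N : ℝ × ℝ → Fin 3 → ℝ) (x : ℝ × ℝ) : Fin 3 → ℝ :=
  fun i => N x i / stereoDenom lam x ^ k

theorem pd1_stereoQuot (lam : ℝ) (k : ℕ) {N N' : ℝ × ℝ → Fin 3 → ℝ}
    (hN : Differentiable ℝ N) (hN' : ∀ x i, HasDerivAt (fun t => N (t, x.2) i) (N' x i) x.1) :
    pd1 (stereoQuot lam (k + 1) N) = stereoQuot lam (k + 2) fun x i =>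
      N' x i * stereoDenom lam x - (k + 1) * N x i * (2 * lam ^ 2 * x.1) := by
  funext x
  refine pd1_eq_of_hasDerivAt ?_ fun i => ?_
  · refine differentiableAt_pi.2 fun i => ?_
    have h := differentiableAt_pi.1 (hN x) i
    have hD := differentiable_stereoDenom lam x
    have hk : stereoDenom lam x ^ (k + 1) ≠ 0 := pow_ne_zero _ (stereoDenom_pos lam x).ne'
    unfold stereoQuot
    fun_prop (disch := exact hk)
  · exact (hN' x i).div_pow_succ k (hasDerivAt_stereoDenom_fst lam x) (stereoDenom_pos lam x).ne'

theorem pd2_stereoQuot (lam : ℝ) (k : ℕ) {N N' : ℝ × ℝ → Fin 3 → ℝ}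
    (hN : Differentiable ℝ N) (hN' : ∀ x i, HasDerivAt (fun t => N (x.1, t) i) (N' x i) x.2) :
    pd2 (stereoQuot lam (k + 1) N) = stereoQuot lam (k + 2) fun x i =>
      N' x i * stereoDenom lam x - (k + 1) * N x i * (2 * lam ^ 2 * x.2) := by
  funext x
  refine pd2_eq_of_hasDerivAt ?_ fun i => ?_
  · refine differentiableAt_pi.2 fun i => ?_
    have h := differentiableAt_pi.1 (hN x) i
    have hD := differentiable_stereoDenom lam x
    have hk : stereoDenom lam x ^ (k + 1) ≠ 0 := pow_ne_zero _ (stereoDenom_pos lam x).ne'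
    unfold stereoQuot
    fun_prop (disch := exact hk)
  · exact (hN' x i).div_pow_succ k (hasDerivAt_stereoDenom_snd lam x) (stereoDenom_pos lam x).ne'

/-- The numerators of `π_λ`. -/
def piNum (lam : ℝ) (x : ℝ × ℝ) : Fin 3 → ℝ :=
  ![2 * lam * x.1, 2 * lam * x.2, 1 - lam ^ 2 * (x.1 ^ 2 + x.2 ^ 2)]

/-- The numerators of `∂_λ π_λ` over the squared denominator. -/
def dlamNum (lam : ℝ) (x : ℝ × ℝ) : Fin 3 → ℝ :=
  ![2 * x.1 * (1 - lam ^ 2 * (x.1 ^ 2 + x.2 ^ 2)), 2 * x.2 * (1 - lam ^ 2 * (x.1 ^ 2 + x.2 ^ 2)),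
    -4 * lam * (x.1 ^ 2 + x.2 ^ 2)]

theorem differentiable_piNum (lam : ℝ) : Differentiable ℝ (piNum lam) := by
  refine differentiable_pi.2 fun i => ?_
  fin_cases i <;> simp [piNum]
  fun_prop

theorem differentiable_dlamNum (lam : ℝ) : Differentiable ℝ (dlamNum lam) := by
  refine differentiable_pi.2 fun i => ?_
  fin_cases i <;> simp [dlamNum] <;> fun_prop

theorem piL_eq_stereoQuot (lam : ℝ) : piL lam = stereoQuot lam 1 (piNum lam) := by
  funext x i
  fin_cases i <;> simp [piL, stereoQuot, piNum, stereoDenom]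

theorem dlamPi_eq_stereoQuot (lam : ℝ) : dlamPi lam = stereoQuot lam 2 (dlamNum lam) := by
  funext x
  have hN : ∀ i, HasDerivAt (fun l => piNum l x i)
      ((![2 * x.1, 2 * x.2, -2 * lam * (x.1 ^ 2 + x.2 ^ 2)] : Fin 3 → ℝ) i) lam := by
    intro i
    fin_cases i
    · simpa [piNum] using ((hasDerivAt_id lam).const_mul 2).mul_const x.1
    · simpa [piNum] using ((hasDerivAt_id lam).const_mul 2).mul_const x.2
    · simpa [piNum] using
        (((hasDerivAt_id lam).fun_pow 2).mul_const (x.1 ^ 2 + x.2 ^ 2)).const_sub 1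
  have h : HasDerivAt (fun l => stereoQuot l 1 (piNum l) x) _ lam :=
    hasDerivAt_pi.2 fun i =>
      (hN i).div_pow_succ 0 (hasDerivAt_stereoDenom_scale lam x) (stereoDenom_pos lam x).ne'
  simp only [dlamPi, piL_eq_stereoQuot, h.deriv]
  funext i
  fin_cases i <;> simp [stereoQuot, piNum, dlamNum] <;> congr 1 <;> unfold stereoDenom <;> ring

theorem pd1_pd1_stereoQuot (lam : ℝ) (k : ℕ) {N N' N'' : ℝ × ℝ → Fin 3 → ℝ}
    (hN : Differentiable ℝ N) (hN₁ : Differentiable ℝ N')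
    (hN' : ∀ x i, HasDerivAt (fun t => N (t, x.2) i) (N' x i) x.1)
    (hN'' : ∀ x i, HasDerivAt (fun t => N' (t, x.2) i) (N'' x i) x.1) :
    pd1 (pd1 (stereoQuot lam (k + 1) N)) = stereoQuot lam (k + 3) fun x i =>
      (N'' x i * stereoDenom lam x + N' x i * (2 * lam ^ 2 * x.1)
        - ((k + 1) * N' x i * (2 * lam ^ 2 * x.1) + (k + 1) * N x i * (2 * lam ^ 2)))
          * stereoDenom lam x
        - (k + 2) * (N' x i * stereoDenom lam x - (k + 1) * N x i * (2 * lam ^ 2 * x.1))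
          * (2 * lam ^ 2 * x.1) := by
  rw [pd1_stereoQuot lam k hN hN', pd1_stereoQuot lam (k + 1)
    (N' := fun x i => N'' x i * stereoDenom lam x + N' x i * (2 * lam ^ 2 * x.1)
      - ((k + 1) * N' x i * (2 * lam ^ 2 * x.1) + (k + 1) * N x i * (2 * lam ^ 2)))]
  · funext x i
    simp only [stereoQuot]
    push_cast
    ring
  · refine differentiable_pi.2 fun i => ?_
    have h := differentiable_pi.1 hN i
    have h' := differentiable_pi.1 hN₁ i
    fun_prop
  · intro x i
    simpa using ((hN'' x i).fun_mul (hasDerivAt_stereoDenom_fst lam x)).fun_sub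
      (((hN' x i).const_mul ((k : ℝ) + 1)).fun_mul
        ((hasDerivAt_id x.1).const_mul (2 * lam ^ 2)))

theorem pd2_pd2_stereoQuot (lam : ℝ) (k : ℕ) {N N' N'' : ℝ × ℝ → Fin 3 → ℝ}
    (hN : Differentiable ℝ N) (hN₁ : Differentiable ℝ N')
    (hN' : ∀ x i, HasDerivAt (fun t => N (x.1, t) i) (N' x i) x.2)
    (hN'' : ∀ x i, HasDerivAt (fun t => N' (x.1, t) i) (N'' x i) x.2) :
    pd2 (pd2 (stereoQuot lam (k + 1) N)) = stereoQuot lam (k + 3) fun x i =>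
      (N'' x i * stereoDenom lam x + N' x i * (2 * lam ^ 2 * x.2)
        - ((k + 1) * N' x i * (2 * lam ^ 2 * x.2) + (k + 1) * N x i * (2 * lam ^ 2)))
          * stereoDenom lam x
        - (k + 2) * (N' x i * stereoDenom lam x - (k + 1) * N x i * (2 * lam ^ 2 * x.2))
          * (2 * lam ^ 2 * x.2) := by
  rw [pd2_stereoQuot lam k hN hN', pd2_stereoQuot lam (k + 1)
    (N' := fun x i => N'' x i * stereoDenom lam x + N' x i * (2 * lam ^ 2 * x.2)
      - ((k + 1) * N' x i * (2 * lam ^ 2 * x.2) + (k + 1) * N x i * (2 * lam ^ 2)))]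
  · funext x i
    simp only [stereoQuot]
    push_cast
    ring
  · refine differentiable_pi.2 fun i => ?_
    have h := differentiable_pi.1 hN i
    have h' := differentiable_pi.1 hN₁ i
    fun_prop
  · intro x i
    simpa using ((hN'' x i).fun_mul (hasDerivAt_stereoDenom_snd lam x)).fun_sub
      (((hN' x i).const_mul ((k : ℝ) + 1)).fun_mul
        ((hasDerivAt_id x.2).const_mul (2 * lam ^ 2)))

theorem hasDerivAt_cubic (a b c d t : ℝ) :
    HasDerivAt (fun s => a + b * s + c * s ^ 2 + d * s ^ 3) (b + 2 * c * t + 3 * d * t ^ 2) t := by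
  refine (((((hasDerivAt_id' t).const_mul b).const_add a).fun_add
    (((hasDerivAt_id' t).fun_pow 2).const_mul c)).fun_add
    (((hasDerivAt_id' t).fun_pow 3).const_mul d)).congr_deriv ?_
  simp; ring

/-- `|∇π_λ|² = 8λ² / (1 + λ²|x|²)²`. -/
theorem gradSq_piL (lam : ℝ) (x : ℝ × ℝ) :
    gradSq (piL lam) x = 8 * lam ^ 2 / stereoDenom lam x ^ 2 := by
  have h1 : ∀ (x : ℝ × ℝ) i, HasDerivAt (fun t => piNum lam (t, x.2) i)
      ((![2 * lam, 0, -2 * lam ^ 2 * x.1] : Fin 3 → ℝ) i) x.1 := by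
    intro x i
    fin_cases i
    · convert hasDerivAt_cubic 0 (2 * lam) 0 0 x.1 using 1 <;> simp [piNum]
    · convert hasDerivAt_cubic (2 * lam * x.2) 0 0 0 x.1 using 1 <;> simp [piNum]
    · convert hasDerivAt_cubic (1 - lam ^ 2 * x.2 ^ 2) 0 (-lam ^ 2) 0 x.1 using 1
      · funext t; simp [piNum]; ring
      · simp
  have h2 : ∀ (x : ℝ × ℝ) i, HasDerivAt (fun t => piNum lam (x.1, t) i)
      ((![0, 2 * lam, -2 * lam ^ 2 * x.2] : Fin 3 → ℝ) i) x.2 := by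
    intro x i
    fin_cases i
    · convert hasDerivAt_cubic (2 * lam * x.1) 0 0 0 x.2 using 1 <;> simp [piNum]
    · convert hasDerivAt_cubic 0 (2 * lam) 0 0 x.2 using 1 <;> simp [piNum]
    · convert hasDerivAt_cubic (1 - lam ^ 2 * x.1 ^ 2) 0 (-lam ^ 2) 0 x.2 using 1
      · funext t; simp [piNum]; ring
      · simp
  have hD := (stereoDenom_pos lam x).ne'
  rw [piL_eq_stereoQuot, gradSq, pd1_stereoQuot lam 0 (differentiable_piNum lam) h1,
    pd2_stereoQuot lam 0 (differentiable_piNum lam) h2]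
  simp [dot3, stereoQuot, piNum]
  field_simp
  unfold stereoDenom
  ring

/-- The Laplacian of `∂_λ π_λ` in closed form. -/
theorem lap_dlamPi (lam : ℝ) (x : ℝ × ℝ) :
    lap (dlamPi lam) x = (-(8 * lam ^ 2) / stereoDenom lam x ^ 2) • dlamPi lam x
      + (-(16 * lam) * (1 - lam ^ 2 * (x.1 ^ 2 + x.2 ^ 2)) / stereoDenom lam x ^ 3)
        • piL lam x := by
  have h1 : ∀ (x : ℝ × ℝ) i, HasDerivAt (fun t => dlamNum lam (t, x.2) i)
      ((![2 - 2 * lam ^ 2 * x.2 ^ 2 - 6 * lam ^ 2 * x.1 ^ 2, -4 * lam ^ 2 * x.1 * x.2,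
        -8 * lam * x.1] : Fin 3 → ℝ) i) x.1 := by
    intro x i
    fin_cases i
    · convert hasDerivAt_cubic 0 (2 - 2 * lam ^ 2 * x.2 ^ 2) 0 (-2 * lam ^ 2) x.1 using 1
      · funext t; simp [dlamNum]; ring
      · simp [-mul_eq_mul_right_iff]; ring
    · convert hasDerivAt_cubic (2 * x.2 - 2 * lam ^ 2 * x.2 ^ 3) 0 (-2 * lam ^ 2 * x.2) 0 x.1
        using 1
      · funext t; simp [dlamNum]; ring
      · simp [-mul_eq_mul_right_iff]; ring
    · convert hasDerivAt_cubic (-4 * lam * x.2 ^ 2) 0 (-4 * lam) 0 x.1 using 1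
      · funext t; simp [dlamNum]; ring
      · simp [-mul_eq_mul_right_iff]; ring
  have h1' : ∀ (x : ℝ × ℝ) i, HasDerivAt (fun t =>
        (![2 - 2 * lam ^ 2 * x.2 ^ 2 - 6 * lam ^ 2 * t ^ 2, -4 * lam ^ 2 * t * x.2,
          -8 * lam * t] : Fin 3 → ℝ) i)
      ((![-12 * lam ^ 2 * x.1, -4 * lam ^ 2 * x.2, -8 * lam] : Fin 3 → ℝ) i) x.1 := by
    intro x i
    fin_cases i
    · convert hasDerivAt_cubic (2 - 2 * lam ^ 2 * x.2 ^ 2) 0 (-6 * lam ^ 2) 0 x.1 using 1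
      · funext t; simp; ring
      · simp [-mul_eq_mul_right_iff]; ring
    · convert hasDerivAt_cubic 0 (-4 * lam ^ 2 * x.2) 0 0 x.1 using 1
      · funext t; simp; ring
      · simp
    · convert hasDerivAt_cubic 0 (-8 * lam) 0 0 x.1 using 1 <;> simp
  have h2 : ∀ (x : ℝ × ℝ) i, HasDerivAt (fun t => dlamNum lam (x.1, t) i)
      ((![-4 * lam ^ 2 * x.1 * x.2, 2 - 2 * lam ^ 2 * x.1 ^ 2 - 6 * lam ^ 2 * x.2 ^ 2,
        -8 * lam * x.2] : Fin 3 → ℝ) i) x.2 := by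
    intro x i
    fin_cases i
    · convert hasDerivAt_cubic (2 * x.1 - 2 * lam ^ 2 * x.1 ^ 3) 0 (-2 * lam ^ 2 * x.1) 0 x.2
        using 1
      · funext t; simp [dlamNum]; ring
      · simp [-mul_eq_mul_right_iff]; ring
    · convert hasDerivAt_cubic 0 (2 - 2 * lam ^ 2 * x.1 ^ 2) 0 (-2 * lam ^ 2) x.2 using 1
      · funext t; simp [dlamNum]; ring
      · simp [-mul_eq_mul_right_iff]; ring
    · convert hasDerivAt_cubic (-4 * lam * x.1 ^ 2) 0 (-4 * lam) 0 x.2 using 1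
      · funext t; simp [dlamNum]; ring
      · simp [-mul_eq_mul_right_iff]; ring
  have h2' : ∀ (x : ℝ × ℝ) i, HasDerivAt (fun t =>
        (![-4 * lam ^ 2 * x.1 * t, 2 - 2 * lam ^ 2 * x.1 ^ 2 - 6 * lam ^ 2 * t ^ 2,
          -8 * lam * t] : Fin 3 → ℝ) i)
      ((![-4 * lam ^ 2 * x.1, -12 * lam ^ 2 * x.2, -8 * lam] : Fin 3 → ℝ) i) x.2 := by
    intro x i
    fin_cases i
    · convert hasDerivAt_cubic 0 (-4 * lam ^ 2 * x.1) 0 0 x.2 using 1 <;> simp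
    · convert hasDerivAt_cubic (2 - 2 * lam ^ 2 * x.1 ^ 2) 0 (-6 * lam ^ 2) 0 x.2 using 1
      · funext t; simp; ring
      · simp [-mul_eq_mul_right_iff]; ring
    · convert hasDerivAt_cubic 0 (-8 * lam) 0 0 x.2 using 1 <;> simp
  have hD := (stereoDenom_pos lam x).ne'
  rw [lap, dlamPi_eq_stereoQuot, piL_eq_stereoQuot,
    pd1_pd1_stereoQuot lam 1 (differentiable_dlamNum lam) ?_ h1 h1',
    pd2_pd2_stereoQuot lam 1 (differentiable_dlamNum lam) ?_ h2 h2']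
  · funext i
    fin_cases i <;> simp [stereoQuot, dlamNum, piNum] <;> field_simp <;>
      unfold stereoDenom <;> ring
  all_goals
    refine differentiable_pi.2 fun i => ?_
    fin_cases i <;> simp <;> fun_prop

/-- `Δ(∂_λπ_λ) + |∇π_λ|² ∂_λπ_λ = −(2/λ) |∇π_λ|² π_λ³ π_λ`. -/
theorem stmt4 (lam : ℝ) (hlam : 0 < lam) (x : ℝ × ℝ) :
    lap (dlamPi lam) x + gradSq (piL lam) x • dlamPi lam x
      = (-(2 / lam) * gradSq (piL lam) x * piL lam x 2) • piL lam x := by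
  have hD := (stereoDenom_pos lam x).ne'
  rw [lap_dlamPi, gradSq_piL]
  have h3 : piL lam x 2 = (1 - lam ^ 2 * (x.1 ^ 2 + x.2 ^ 2)) / stereoDenom lam x := by
    simp [piL, stereoDenom]
  rw [h3]
  funext i
  simp only [Pi.add_apply, Pi.smul_apply, smul_eq_mul]
  field_simp
  ring
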